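/- Let u be a solution of problem (1D) and let 0 ≤ t0 < t1 < +∞ be such that u′(t) > 0 for all t ∈ (t0, t1) and u′(t1) = 0. Then for every t ∈ [t0, t1], ∫_{u(t0)}^{u(t)} (F(u(t1)) − F(s))^{−1/p} ds = (p/(p−1))^{1/p} (t − t0). -/

import Mathlib

open Real Filter Set Topology MeasureTheory

/-- `Fint f t = ∫_0^t f(s) ds`. -/
noncomputable def Fint (f : ℝ → ℝ) (t : ℝ) : ℝ := ∫ s in (0:ℝ)..t, f s

/-- The zero set of `f` in `[0,∞)`. -/
def Zf (f : ℝ → ℝ) : Set ℝ := {z : ℝ | 0 ≤ z ∧ f z = 0}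

/-- `f` is locally Lipschitz on the set `s`. -/
def LocLipOn (f : ℝ → ℝ) (s : Set ℝ) : Prop :=
  ∀ x ∈ s, ∃ K : NNReal, ∃ t ∈ nhdsWithin x s, LipschitzOnWith K f t

/-- Condition (SMP): at every zero `z` of `f`,
`liminf_{t→z⁺} f(t)/(t−z)^{p−1} > −∞` and `limsup_{t→z⁻} f(t)/(z−t)^{p−1} < +∞`. -/
def SMP (p : ℝ) (f : ℝ → ℝ) : Prop :=
  ∀ z ∈ Zf f,
    (⊥ : EReal) <
      Filter.liminf (fun t : ℝ => ((f t / (t - z) ^ (p - 1) : ℝ) : EReal))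
        (nhdsWithin z (Set.Ioi z)) ∧
    Filter.limsup (fun t : ℝ => ((f t / (z - t) ^ (p - 1) : ℝ) : EReal))
      (nhdsWithin z (Set.Ico 0 z)) < (⊤ : EReal)

/-- A solution of problem (1D): a bounded nonnegative `C¹` function `u` on `[0,∞)`
with `u(0)=0`, derivative `u'`, such that `t ↦ |u'(t)|^{p−2} u'(t)` is differentiable
on `(0,∞)` with derivative `−f(u(t))` there. -/
structure Sol1D (p : ℝ) (f : ℝ → ℝ) (u u' : ℝ → ℝ) : Prop where
  hasDeriv : ∀ t ∈ Set.Ici (0:ℝ), HasDerivWithinAt u (u' t) (Set.Ici (0:ℝ)) t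
  derivCont : ContinuousOn u' (Set.Ici (0:ℝ))
  bounded : ∃ M : ℝ, ∀ t ∈ Set.Ici (0:ℝ), |u t| ≤ M
  zeroAtZero : u 0 = 0
  nonneg : ∀ t ∈ Set.Ici (0:ℝ), 0 ≤ u t
  ode : ∀ t ∈ Set.Ioi (0:ℝ),
    HasDerivAt (fun s : ℝ => |u' s| ^ (p - 2) * u' s) (-(f (u t))) t

/-- A primitive of a function continuous on `[0,∞)` is differentiable at positive points. -/
theorem hasDerivAt_Fint {f : ℝ → ℝ} (hf : ContinuousOn f (Set.Ici 0)) {x : ℝ} (hx : 0 < x) :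
    HasDerivAt (Fint f) (f x) x := by
  have hint : IntervalIntegrable f volume 0 x := by
    apply ContinuousOn.intervalIntegrable
    rw [uIcc_of_le hx.le]
    exact hf.mono fun y hy => hy.1
  exact intervalIntegral.integral_hasDerivAt_right hint
    ((hf.mono Ioi_subset_Ici_self).stronglyMeasurableAtFilter isOpen_Ioi x hx)
    (hf.continuousAt (Ici_mem_nhds hx))

namespace Sol1D

variable {p : ℝ} {f u u' : ℝ → ℝ}

theorem hasDerivAt (hu : Sol1D p f u u') {t : ℝ} (ht : 0 < t) : HasDerivAt u (u' t) t :=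
  (hu.hasDeriv t ht.le).hasDerivAt (Ici_mem_nhds ht)

theorem continuousOn (hu : Sol1D p f u u') : ContinuousOn u (Set.Ici 0) :=
  fun t ht => (hu.hasDeriv t ht).continuousWithinAt

theorem strictMonoOn (hu : Sol1D p f u u') {a b : ℝ} (ha : 0 ≤ a)
    (hpos : ∀ t ∈ Set.Ioo a b, 0 < u' t) : StrictMonoOn u (Set.Icc a b) := by
  apply strictMonoOn_of_deriv_pos (convex_Icc a b)
    (hu.continuousOn.mono fun t ht => ha.trans ht.1)
  intro t ht
  rw [interior_Icc] at ht
  rw [(hu.hasDerivAt (ha.trans_lt ht.1)).deriv]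
  exact hpos t ht

/-- Where `u' > 0`, the energy `(p-1)/p * u'^p + F(u)` has zero derivative. -/
theorem hasDerivAt_energy (hu : Sol1D p f u u') (hp : 1 < p)
    (hf : ContinuousOn f (Set.Ici 0)) {t : ℝ} (ht : 0 < t) (hut : 0 < u t) (hut' : 0 < u' t) :
    HasDerivAt (fun s => (p - 1) / p * u' s ^ p + Fint f (u s)) 0 t := by
  have hp1 : 0 < p - 1 := by linarith
  have hw : ∀ s, 0 < u' s → |u' s| ^ (p - 2) * u' s = u' s ^ (p - 1) := fun s hs => by
    rw [abs_of_pos hs, ← Real.rpow_add_one hs.ne']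
    ring_nf
  have hc : ContinuousAt u' t := hu.derivCont.continuousAt (Ici_mem_nhds ht)
  have hpow := (hu.ode t ht).rpow_const (p := p / (p - 1))
    (Or.inl (by rw [hw t hut']; positivity))
  have hexp : p / (p - 1) - 1 = 1 / (p - 1) := by field_simp; ring
  rw [hw t hut', hexp, ← Real.rpow_mul hut'.le, mul_one_div_cancel hp1.ne', Real.rpow_one] at hpow
  have hE := (hpow.const_mul ((p - 1) / p)).add
    ((hasDerivAt_Fint hf hut).comp t (hu.hasDerivAt ht))
  have hz : (p - 1) / p * (-f (u t) * (p / (p - 1)) * u' t) + f (u t) * u' t = 0 := by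
    field_simp
    ring
  rw [hz] at hE
  refine hE.congr_of_eventuallyEq ?_
  filter_upwards [hc.eventually (lt_mem_nhds hut')] with s hs
  simp only [Pi.add_apply, Function.comp_apply]
  rw [hw s hs, ← Real.rpow_mul hs.le, mul_div_cancel₀ _ hp1.ne']

/-- Energy identity on an interval where `u` increases to a critical point. -/
theorem Fint_sub_Fint (hu : Sol1D p f u u') (hp : 1 < p) (hf : ContinuousOn f (Set.Ici 0))
    {a b : ℝ} (ha : 0 ≤ a) (hpos : ∀ t ∈ Set.Ioo a b, 0 < u' t) (hb : u' b = 0)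
    {t : ℝ} (ht : t ∈ Set.Ioo a b) :
    Fint f (u b) - Fint f (u t) = (p - 1) / p * u' t ^ p := by
  have hab : a < b := ht.1.trans ht.2
  have hupos : ∀ s ∈ Set.Ioc a b, 0 < u s := fun s hs =>
    (hu.nonneg a ha).trans_lt
      (hu.strictMonoOn ha hpos ⟨le_rfl, hab.le⟩ ⟨hs.1.le, hs.2⟩ hs.1)
  have hcont : ContinuousOn (fun s => (p - 1) / p * u' s ^ p + Fint f (u s)) (Set.Icc t b) := by
    intro s hs
    have hs0 : 0 < s := ha.trans_lt (ht.1.trans_le hs.1)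
    have h1 : ContinuousAt u' s := hu.derivCont.continuousAt (Ici_mem_nhds hs0)
    have h2 : ContinuousAt (fun s => Fint f (u s)) s :=
      ContinuousAt.comp (hasDerivAt_Fint hf (hupos s ⟨ht.1.trans_le hs.1, hs.2⟩)).continuousAt
        (hu.hasDerivAt hs0).continuousAt
    exact (((h1.rpow_const (Or.inr (by linarith))).const_mul _).add h2).continuousWithinAt
  obtain ⟨c, hc, hcd⟩ := exists_hasDerivAt_eq_slope _ (fun _ => (0 : ℝ)) ht.2 hcont
    fun s hs => hu.hasDerivAt_energy hp hf (ha.trans_lt (ht.1.trans hs.1))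
      (hupos s ⟨ht.1.trans hs.1, hs.2.le⟩) (hpos s ⟨ht.1.trans hs.1, hs.2⟩)
  have hbt : b - t ≠ 0 := (sub_pos.2 ht.2).ne'
  rw [eq_comm, div_eq_zero_iff, or_iff_left hbt, hb, Real.zero_rpow (by linarith)] at hcd
  linarith

end Sol1D

theorem stmt5 (p : ℝ) (hp : 1 < p) (f : ℝ → ℝ)
    (hfc : ContinuousOn f (Set.Ici 0))
    (hflip : LocLipOn f (Set.Ici 0 \ Zf f))
    (hsmp : SMP p f)
    (u u' : ℝ → ℝ) (hu : Sol1D p f u u')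
    (t0 t1 : ℝ) (ht0 : 0 ≤ t0) (ht01 : t0 < t1)
    (hpos : ∀ t ∈ Set.Ioo t0 t1, 0 < u' t) (ht1 : u' t1 = 0) :
    ∀ t ∈ Set.Icc t0 t1,
      (∫ s in (u t0)..(u t), (Fint f (u t1) - Fint f s) ^ (-(1/p)))
        = (p / (p - 1)) ^ (1/p) * (t - t0) := by
  intro t ht
  have hmono : StrictMonoOn u (Set.Icc t0 t) :=
    (hu.strictMonoOn ht0 hpos).mono (Icc_subset_Icc_right ht.2)
  have himage : u '' Set.Ioo t0 t = Set.Ioo (u t0) (u t) := by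
    apply Set.Subset.antisymm
    · rintro _ ⟨s, hs, rfl⟩
      exact ⟨hmono ⟨le_rfl, ht.1⟩ ⟨hs.1.le, hs.2.le⟩ hs.1,
        hmono ⟨hs.1.le, hs.2.le⟩ ⟨ht.1, le_rfl⟩ hs.2⟩
    · exact intermediate_value_Ioo ht.1 (hu.continuousOn.mono fun s hs => ht0.trans hs.1)
  have hle : u t0 ≤ u t := hmono.monotoneOn ⟨le_rfl, ht.1⟩ ⟨ht.1, le_rfl⟩ ht.1
  have hp1 : 0 < p - 1 := by linarith
  have hp0 : 0 < p := by linarith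
  rw [intervalIntegral.integral_of_le hle, integral_Ioc_eq_integral_Ioo, ← himage,
    integral_image_eq_integral_abs_deriv_smul measurableSet_Ioo
      (fun s hs => (hu.hasDerivAt (ht0.trans_lt hs.1)).hasDerivWithinAt)
      (hmono.injOn.mono Ioo_subset_Icc_self)]
  have hconst : ∀ s ∈ Set.Ioo t0 t,
      |u' s| • (Fint f (u t1) - Fint f (u s)) ^ (-(1/p)) = (p / (p - 1)) ^ (1/p) := by
    intro s hs
    have hs1 : s ∈ Set.Ioo t0 t1 := ⟨hs.1, hs.2.trans_le ht.2⟩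
    have hs' := hpos s hs1
    rw [hu.Fint_sub_Fint hp hfc ht0 hpos ht1 hs1, abs_of_pos hs', smul_eq_mul,
      Real.mul_rpow (by positivity) (by positivity), ← Real.rpow_mul hs'.le,
      Real.rpow_neg (by positivity), ← Real.inv_rpow (by positivity), inv_div,
      mul_neg, mul_one_div_cancel hp0.ne', Real.rpow_neg_one]
    field_simp
  rw [setIntegral_congr_fun measurableSet_Ioo hconst, setIntegral_const,
    Real.volume_real_Ioo_of_le ht.1,
    smul_eq_mul, mul_comm]
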